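/- arXiv:2302.06035 — 3 statements merged into one kernel-verified Lean document; each statement's English description precedes it below -/
import Mathlib

section
/- Let λ > 0 and k > 0 be fixed, and for each n ≥ 1 let q_n be the truncated generalized gamma density on [0,1] with parameters λ, k, and β = n. Define Ψ₁(n) := −n · E_{q_n}[ξ^{2k}] − E_{q_n}[log q_n(ξ)] + (2kλ − 1) · E_{q_n}[log ξ]. Then lim_{n → ∞} ( Ψ₁(n) + λ log n ) = log( Γ(λ) / (2k) ). In particular Ψ₁(n) = −λ log n + O(1) as n → ∞. -/
open MeasureTheory Filter Asymptotics

lemma aux_limit (lam k : ℝ) (hlam : 0 < lam) (hk : 0 < k) :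
    Tendsto (fun n : ℕ => (n : ℝ) ^ lam *
      ∫ s in (0:ℝ)..1, s ^ (2 * k * lam - 1) * Real.exp (-(n : ℝ) * s ^ (2 * k)))
      atTop (nhds (Real.Gamma lam / (2 * k))) := by
  have h2k : 0 < 2 * k := by positivity
  have hval := integral_rpow_mul_exp_neg_rpow (p := 2 * k) (q := 2 * k * lam - 1) h2k
    (by nlinarith [mul_pos h2k hlam])
  have hG : 1 / (2 * k) * Real.Gamma ((2 * k * lam - 1 + 1) / (2 * k))
      = Real.Gamma lam / (2 * k) := by
    have : (2 * k * lam - 1 + 1) / (2 * k) = lam := by field_simp; ring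
    rw [this]; ring
  rw [hG] at hval
  have hpos : 0 < Real.Gamma lam / (2 * k) := div_pos (Real.Gamma_pos_of_pos hlam) h2k
  have hint : IntegrableOn (fun x : ℝ => x ^ (2 * k * lam - 1) * Real.exp (-x ^ (2 * k)))
      (Set.Ioi 0) := by
    by_contra h
    rw [integral_undef h] at hval
    exact hpos.ne hval
  have hc : Tendsto (fun n : ℕ => (n : ℝ) ^ (1 / (2 * k))) atTop atTop :=
    (tendsto_rpow_atTop (by positivity)).comp tendsto_natCast_atTop_atTop
  have := intervalIntegral_tendsto_integral_Ioi 0 hint hc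
  rw [hval] at this
  refine this.congr' ?_
  filter_upwards [eventually_gt_atTop 0] with n hn
  have hn' : (0:ℝ) < n := by exact_mod_cast hn
  set c : ℝ := (n : ℝ) ^ (1 / (2 * k)) with hcdef
  have hcpos : 0 < c := Real.rpow_pos_of_pos hn' _
  have hck : c ^ (2 * k) = n := by
    rw [hcdef, ← Real.rpow_mul hn'.le]
    rw [one_div, inv_mul_cancel₀ h2k.ne', Real.rpow_one]
  have h1 := intervalIntegral.mul_integral_comp_mul_left (a := 0) (b := 1)
    (f := fun x : ℝ => x ^ (2 * k * lam - 1) * Real.exp (-x ^ (2 * k))) c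
  rw [mul_zero, mul_one] at h1
  rw [← h1]
  have hcl : (n : ℝ) ^ lam = c * c ^ (2 * k * lam - 1) := by
    rw [Real.rpow_sub_one hcpos.ne', Real.rpow_mul hcpos.le, hck]
    field_simp
  rw [hcl, mul_assoc c, ← intervalIntegral.integral_const_mul (c ^ (2 * k * lam - 1))]
  congr 1
  apply intervalIntegral.integral_congr
  intro x hx
  rw [Set.uIcc_of_le zero_le_one] at hx
  simp only
  rw [Real.mul_rpow hcpos.le hx.1, Real.mul_rpow hcpos.le hx.1, hck, neg_mul]
  ring

lemma aux_int_log (a : ℝ) (ha : 0 < a) :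
    IntervalIntegrable (fun s : ℝ => s ^ (a - 1) * Real.log s) volume 0 1 := by
  have h0 : IntervalIntegrable (fun s : ℝ => (2 / a) * s ^ (a / 2 - 1)) volume 0 1 :=
    (intervalIntegral.intervalIntegrable_rpow' (by linarith)).const_mul _
  refine h0.mono_fun' (by fun_prop) ?_
  rw [Set.uIoc_of_le zero_le_one]
  refine (ae_restrict_iff' measurableSet_Ioc).2 (Eventually.of_forall ?_)
  intro x hx
  have h := (Real.abs_log_mul_self_rpow_lt x (a / 2) hx.1 hx.2 (by positivity)).le
  have e : x ^ (a - 1) * Real.log x = (Real.log x * x ^ (a / 2)) * x ^ (a / 2 - 1) := by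
    rw [mul_assoc, ← Real.rpow_add hx.1, mul_comm]
    congr 2; ring
  have hp : 0 ≤ x ^ (a / 2 - 1) := Real.rpow_nonneg hx.1.le _
  beta_reduce
  rw [e, Real.norm_eq_abs, abs_mul, abs_of_nonneg hp]
  refine mul_le_mul_of_nonneg_right (h.trans (le_of_eq ?_)) hp
  field_simp

lemma aux_exact (a p t : ℝ) (ha : 0 < a) (hp : 0 < p) (B : ℝ)
    (hB : B = ∫ s in (0:ℝ)..1, s ^ (a - 1) * Real.exp (-t * s ^ p)) (q : ℝ → ℝ)
    (hq : ∀ x, q x = B⁻¹ * x ^ (a - 1) * Real.exp (-t * x ^ p)) :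
    0 < B ∧ -t * (∫ x in (0:ℝ)..1, x ^ p * q x) - (∫ x in (0:ℝ)..1, q x * Real.log (q x))
        + (a - 1) * (∫ x in (0:ℝ)..1, q x * Real.log x) = Real.log B := by
  have hpc : Continuous (fun x : ℝ => x ^ p) := Real.continuous_rpow_const hp.le
  have hec : Continuous (fun x : ℝ => Real.exp (-t * x ^ p)) := by fun_prop
  have hi0 : IntervalIntegrable (fun s : ℝ => s ^ (a - 1)) volume 0 1 :=
    intervalIntegral.intervalIntegrable_rpow' (by linarith)
  have hi1 : IntervalIntegrable (fun s : ℝ => s ^ (a - 1) * Real.exp (-t * s ^ p)) volume 0 1 :=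
    hi0.mul_continuousOn hec.continuousOn
  have hBpos : 0 < B := by
    rw [hB]
    refine intervalIntegral.intervalIntegral_pos_of_pos_on hi1 ?_ zero_lt_one
    intro x hx
    exact mul_pos (Real.rpow_pos_of_pos hx.1 _) (Real.exp_pos _)
  refine ⟨hBpos, ?_⟩
  have hqe : q = fun x => B⁻¹ * (x ^ (a - 1) * Real.exp (-t * x ^ p)) := by
    funext x; rw [hq]; ring
  have iq : IntervalIntegrable q volume 0 1 := by rw [hqe]; exact hi1.const_mul _
  have ipq : IntervalIntegrable (fun x => x ^ p * q x) volume 0 1 :=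
    iq.continuousOn_mul hpc.continuousOn
  have ilq : IntervalIntegrable (fun x => q x * Real.log x) volume 0 1 := by
    have := ((aux_int_log a ha).mul_continuousOn hec.continuousOn).const_mul B⁻¹
    refine this.congr (fun x _ => ?_)
    simp only [hq]; ring
  have hq1 : ∫ x in (0:ℝ)..1, q x = 1 := by
    rw [hqe, intervalIntegral.integral_const_mul, ← hB, inv_mul_cancel₀ hBpos.ne']
  have key : ∫ x in (0:ℝ)..1, q x * Real.log (q x) =
      ∫ x in (0:ℝ)..1, (-Real.log B * q x + (a - 1) * (q x * Real.log x)
        + -t * (x ^ p * q x)) := by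
    apply intervalIntegral.integral_congr_ae
    refine Eventually.of_forall (fun x hx => ?_)
    rw [Set.uIoc_of_le zero_le_one] at hx
    have hxp : 0 < x ^ (a - 1) := Real.rpow_pos_of_pos hx.1 _
    have : Real.log (q x) = -Real.log B + (a - 1) * Real.log x + -t * x ^ p := by
      rw [hq, Real.log_mul (by positivity) (Real.exp_pos _).ne',
        Real.log_mul (by positivity) hxp.ne', Real.log_inv, Real.log_exp, Real.log_rpow hx.1]
    rw [this]; ring
  rw [key, intervalIntegral.integral_add ((iq.const_mul _).add (ilq.const_mul _))
    (ipq.const_mul _), intervalIntegral.integral_add (iq.const_mul _) (ilq.const_mul _),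
    intervalIntegral.integral_const_mul, intervalIntegral.integral_const_mul,
    intervalIntegral.integral_const_mul, hq1]
  ring

/-- For fixed λ, k > 0, let `q_n` be the truncated generalized gamma
density on `[0,1]` with parameters λ, k and β = n, and let
`Ψ₁(n) = -n E_{q_n}[ξ^{2k}] - E_{q_n}[log q_n] + (2kλ-1) E_{q_n}[log ξ]`.  Then
`lim_{n→∞} (Ψ₁(n) + λ log n) = log (Γ(λ)/(2k))`; in particular
`Ψ₁(n) = -λ log n + O(1)` as `n → ∞`. -/
theorem stmt_10 (lam k : ℝ) (hlam : 0 < lam) (hk : 0 < k)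
    (q : ℕ → ℝ → ℝ)
    (hq : ∀ n ξ, q n ξ
      = (∫ s in (0:ℝ)..1, s ^ (2 * k * lam - 1) * Real.exp (-(n : ℝ) * s ^ (2 * k)))⁻¹
          * ξ ^ (2 * k * lam - 1) * Real.exp (-(n : ℝ) * ξ ^ (2 * k)))
    (Ψ₁ : ℕ → ℝ)
    (hΨ₁ : ∀ n, Ψ₁ n
      = -(n : ℝ) * (∫ ξ in (0:ℝ)..1, ξ ^ (2 * k) * q n ξ)
        - (∫ ξ in (0:ℝ)..1, q n ξ * Real.log (q n ξ))
        + (2 * k * lam - 1) * (∫ ξ in (0:ℝ)..1, q n ξ * Real.log ξ)) :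
    Tendsto (fun n : ℕ => Ψ₁ n + lam * Real.log n)
        atTop (nhds (Real.log (Real.Gamma lam / (2 * k))))
    ∧ (fun n : ℕ => Ψ₁ n - (-lam * Real.log n)) =O[atTop] (fun _ : ℕ => (1 : ℝ)) := by
  have hpos : 0 < Real.Gamma lam / (2 * k) :=
    div_pos (Real.Gamma_pos_of_pos hlam) (by positivity)
  have main : Tendsto (fun n : ℕ => Ψ₁ n + lam * Real.log n)
      atTop (nhds (Real.log (Real.Gamma lam / (2 * k)))) := by
    refine ((aux_limit lam k hlam hk).log hpos.ne').congr' ?_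
    filter_upwards [eventually_gt_atTop 0] with n hn
    have hn' : (0:ℝ) < n := by exact_mod_cast hn
    obtain ⟨hB, h⟩ := aux_exact (2 * k * lam) (2 * k) n (by positivity) (by positivity) _ rfl
      (q n) (hq n)
    rw [hΨ₁, h, Real.log_mul (Real.rpow_pos_of_pos hn' _).ne' hB.ne', Real.log_rpow hn']
    ring
  refine ⟨main, ?_⟩
  have h2 := main.isBigO_one ℝ
  refine h2.congr_left (fun n => ?_)
  ring
end

section
/- Define c : ℝ → ℝ by c(b) := ∫₀¹ ( tanh(b x) / b )² dx for b ≠ 0 and c(0) := 1/3. Then c is real-analytic on ℝ and strictly positive everywhere, and the map g⁻¹ : (a, b) ↦ (ξ₁, ξ₂) := ( a·√(c(b)/2), b ) satisfies, for all (a, b) ∈ ℝ², K(a, b) := (a²/2) ∫₀¹ tanh(b x)² dx = ξ₁² · ξ₂². That is, the change of coordinates ξ₁ = a√(c(b)/2), ξ₂ = b puts K into the monomial (normal crossing) form ξ₁² ξ₂². -/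
open MeasureTheory

theorem aux_tanh_deriv (x : ℝ) : HasDerivAt Real.tanh (1 - Real.tanh x ^ 2) x := by
  have h := (Real.hasDerivAt_sinh x).div (Real.hasDerivAt_cosh x) (Real.cosh_pos x).ne'
  have e : Real.tanh = Real.sinh / Real.cosh := by
    funext y; simp [Real.tanh_eq_sinh_div_cosh]
  have h2 : 1 - Real.tanh x ^ 2 =
      (Real.cosh x * Real.cosh x - Real.sinh x * Real.sinh x) / Real.cosh x ^ 2 := by
    have := (Real.cosh_pos x).ne'
    rw [Real.tanh_eq_sinh_div_cosh]
    field_simp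
  rw [h2, e]
  exact h

theorem aux_tanh_analytic (x : ℝ) : AnalyticAt ℝ Real.tanh x := by
  have e : Real.tanh = Real.sinh / Real.cosh := by
    funext y; simp [Real.tanh_eq_sinh_div_cosh]
  rw [e]
  exact Real.analyticAt_sinh.div Real.analyticAt_cosh (Real.cosh_pos x).ne'

theorem aux_tanh_cont : Continuous Real.tanh :=
  continuous_iff_continuousAt.2 fun x => (aux_tanh_deriv x).continuousAt

theorem aux_integral (b : ℝ) (hb : b ≠ 0) :
    ∫ x in (0:ℝ)..1, Real.tanh (b * x) ^ 2 = 1 - Real.tanh b / b := by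
  have h : ∀ x ∈ Set.uIcc (0:ℝ) 1,
      HasDerivAt (fun x => x - Real.tanh (b * x) / b) (Real.tanh (b * x) ^ 2) x := by
    intro x _
    have h1 : HasDerivAt (fun x : ℝ => b * x) b x := by
      simpa using (hasDerivAt_id x).const_mul b
    have h2 := (hasDerivAt_id x).sub (((aux_tanh_deriv (b * x)).comp x h1).div_const b)
    refine HasDerivAt.congr_deriv h2 ?_
    rw [mul_div_cancel_right₀ _ hb]
    ring
  rw [intervalIntegral.integral_eq_sub_of_hasDerivAt h]
  · simp
  · apply Continuous.intervalIntegrable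
    exact (aux_tanh_cont.comp (continuous_const.mul continuous_id)).pow 2

theorem aux_d1 : deriv (fun b : ℝ => b - Real.tanh b) = fun b => Real.tanh b ^ 2 := by
  funext x
  have h := (hasDerivAt_id x).sub (aux_tanh_deriv x)
  refine HasDerivAt.deriv (HasDerivAt.congr_deriv h ?_)
  ring

theorem aux_d2 : deriv (fun b : ℝ => Real.tanh b ^ 2) =
    fun b => 2 * Real.tanh b * (1 - Real.tanh b ^ 2) := by
  funext x
  have h := (aux_tanh_deriv x).pow 2
  refine HasDerivAt.deriv (HasDerivAt.congr_deriv h ?_)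
  simp

theorem aux_d3 : deriv (fun b : ℝ => 2 * Real.tanh b * (1 - Real.tanh b ^ 2)) 0 = 2 := by
  have h := ((aux_tanh_deriv 0).const_mul 2).mul (((aux_tanh_deriv 0).pow 2).const_sub 1)
  refine HasDerivAt.deriv (HasDerivAt.congr_deriv h ?_)
  simp

theorem aux_taylor : ∃ F : ℝ → ℝ, AnalyticAt ℝ F 0 ∧
    ∀ b, b - Real.tanh b = b ^ 3 / 3 + b ^ 4 * F b := by
  have hf : AnalyticAt ℝ (fun b : ℝ => b - Real.tanh b) 0 :=
    analyticAt_id.sub (aux_tanh_analytic 0)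
  obtain ⟨F, hF, h⟩ := hf.exists_eq_sum_add_pow_mul 4
  refine ⟨F, hF, fun b => ?_⟩
  have := h b
  simp only [Finset.sum_range_succ, iteratedDeriv_succ', iteratedDeriv_zero, aux_d1, aux_d2,
    aux_d3] at this
  simp [Nat.factorial] at this
  rw [this]; ring

theorem stmt_14 (c : ℝ → ℝ)
    (hc : ∀ b, c b =
      if b = 0 then 1 / 3 else ∫ x in (0:ℝ)..1, (Real.tanh (b * x) / b) ^ 2) :
    (∀ b, AnalyticAt ℝ c b)
    ∧ (∀ b, 0 < c b)
    ∧ (∀ a b : ℝ,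
        a ^ 2 / 2 * (∫ x in (0:ℝ)..1, Real.tanh (b * x) ^ 2)
          = (a * Real.sqrt (c b / 2)) ^ 2 * b ^ 2) := by
  have hi : ∀ b, b ≠ 0 → c b = (∫ x in (0:ℝ)..1, Real.tanh (b * x) ^ 2) / b ^ 2 := by
    intro b hb
    rw [hc, if_neg hb]
    simp only [div_pow]
    rw [intervalIntegral.integral_div]
  have hcl : ∀ b, b ≠ 0 → c b = (b - Real.tanh b) / b ^ 3 := by
    intro b hb
    rw [hi b hb, aux_integral b hb]
    field_simp
  have hpos : ∀ b, 0 < c b := by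
    intro b
    by_cases hb : b = 0
    · rw [hc, if_pos hb]; norm_num
    · rw [hi b hb]
      apply div_pos _ (by positivity)
      apply intervalIntegral.intervalIntegral_pos_of_pos_on _ _ one_pos
      · apply Continuous.intervalIntegrable
        exact (aux_tanh_cont.comp (continuous_const.mul continuous_id)).pow 2
      · intro x hx
        have h1 : b * x ≠ 0 := mul_ne_zero hb hx.1.ne'
        have h2 : Real.tanh (b * x) ≠ 0 := fun h =>
          h1 (Real.tanh_injective (h.trans Real.tanh_zero.symm))
        positivity
  refine ⟨fun b => ?_, hpos, fun a b => ?_⟩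
  · by_cases hb : b = 0
    · subst hb
      obtain ⟨F, hF, h⟩ := aux_taylor
      have e : c = fun b => 1 / 3 + b * F b := by
        funext b
        by_cases hb : b = 0
        · rw [hc, if_pos hb, hb]; simp
        · rw [hcl b hb, h]; field_simp
      rw [e]
      exact analyticAt_const.add (analyticAt_id.mul hF)
    · have h : AnalyticAt ℝ (fun b : ℝ => (b - Real.tanh b) / b ^ 3) b :=
        (analyticAt_id.sub (aux_tanh_analytic b)).div (analyticAt_id.pow 3) (pow_ne_zero 3 hb)
      refine h.congr ?_
      filter_upwards [isOpen_ne.mem_nhds hb] with y hy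
      exact (hcl y hy).symm
  · by_cases hb : b = 0
    · subst hb; simp
    · rw [mul_pow, Real.sq_sqrt (by have := hpos b; positivity), hi b hb]
      field_simp
end

section
/- lim_{n → ∞} ( √n / log n ) · ∫_{[0,1]²} exp( −n a² b² ) da db = √π / 4. That is, the singular integral ∫_{[0,1]²} e^{−n a² b²} da db, whose phase a²b² is the monomial standard form with multi-index (k₁, k₂) = (1, 1), is asymptotically equivalent to (√π/4) · n^{−1/2} · log n as n → ∞. -/
open MeasureTheory Filter

noncomputable def auxH (s : ℝ) : ℝ := ∫ b in (0:ℝ)..1, Real.exp (-1 * (s * b) ^ 2)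

lemma auxH_cont : Continuous auxH := by
  unfold auxH
  apply intervalIntegral.continuous_parametric_intervalIntegral_of_continuous'
  fun_prop

lemma auxH_mul (s : ℝ) : s * auxH s = ∫ t in (0:ℝ)..s, Real.exp (-1 * t ^ 2) := by
  unfold auxH
  rw [intervalIntegral.mul_integral_comp_mul_left (f := fun t => Real.exp (-1 * t ^ 2))]
  simp

lemma aux_split (s : ℝ) : s * auxH s + ∫ t in Set.Ioi s, Real.exp (-1 * t ^ 2)
    = Real.sqrt Real.pi / 2 := by
  have hi : Integrable (fun t : ℝ => Real.exp (-1 * t ^ 2)) :=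
    integrable_exp_neg_mul_sq one_pos
  rw [auxH_mul, intervalIntegral.integral_interval_add_Ioi hi.integrableOn hi.integrableOn]
  have := integral_gaussian_Ioi 1
  simpa using this

lemma auxH_upper (s : ℝ) (hs : 0 < s) : auxH s ≤ Real.sqrt Real.pi / 2 * s⁻¹ := by
  have h := aux_split s
  have h2 : 0 ≤ ∫ t in Set.Ioi s, Real.exp (-1 * t ^ 2) :=
    integral_nonneg (fun t => (Real.exp_pos _).le)
  rw [← div_eq_mul_inv, le_div_iff₀ hs]
  linarith

lemma auxH_lower (s : ℝ) (hs : 1 ≤ s) :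
    Real.sqrt Real.pi / 2 * s⁻¹ - s ^ (-2 : ℤ) ≤ auxH s := by
  have h := aux_split s
  have hi : Integrable (fun t : ℝ => Real.exp (-1 * t ^ 2)) :=
    integrable_exp_neg_mul_sq one_pos
  have h2 : ∫ t in Set.Ioi s, Real.exp (-1 * t ^ 2) ≤ ∫ t in Set.Ioi s, Real.exp (-t) := by
    refine setIntegral_mono_on hi.integrableOn (integrableOn_exp_neg_Ioi s) measurableSet_Ioi ?_
    intro t ht
    have : s < t := ht
    apply Real.exp_le_exp.2
    nlinarith
  rw [integral_exp_neg_Ioi] at h2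
  have h3 : Real.exp (-s) ≤ s⁻¹ := by
    rw [Real.exp_neg]
    apply inv_anti₀ (by linarith)
    linarith [Real.add_one_le_exp s]
  have hs0 : 0 < s := by linarith
  have e : Real.sqrt Real.pi / 2 * s⁻¹ - s ^ (-2 : ℤ) = (Real.sqrt Real.pi / 2 - s⁻¹) / s := by
    have : s ^ (-2 : ℤ) = (s ^ 2)⁻¹ := by
      rw [zpow_neg]; rfl
    rw [this]
    field_simp
  rw [e, div_le_iff₀ hs0]
  linarith

lemma auxH_nonneg (s : ℝ) : 0 ≤ auxH s :=
  intervalIntegral.integral_nonneg zero_le_one (fun t _ => (Real.exp_pos _).le)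

lemma auxH_le_one (s : ℝ) : auxH s ≤ 1 := by
  have : auxH s ≤ ∫ b in (0:ℝ)..1, (1:ℝ) := by
    apply intervalIntegral.integral_mono_on zero_le_one
    · apply Continuous.intervalIntegrable; fun_prop
    · simp
    · intro x _
      apply Real.exp_le_one_iff.2
      nlinarith [sq_nonneg (s * x)]
  simpa using this

lemma aux_bound (N : ℝ) (hN : 1 ≤ N) :
    |(∫ s in (0:ℝ)..N, auxH s) - Real.sqrt Real.pi / 2 * Real.log N| ≤ 1 := by
  have ii : ∀ a b, IntervalIntegrable auxH volume a b := fun a b => auxH_cont.intervalIntegrable a b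
  rw [← intervalIntegral.integral_add_adjacent_intervals (ii 0 1) (ii 1 N)]
  have a1 : 0 ≤ ∫ s in (0:ℝ)..1, auxH s :=
    intervalIntegral.integral_nonneg zero_le_one (fun t _ => auxH_nonneg t)
  have a2 : ∫ s in (0:ℝ)..1, auxH s ≤ 1 := by
    have : ∫ s in (0:ℝ)..1, auxH s ≤ ∫ b in (0:ℝ)..1, (1:ℝ) :=
      intervalIntegral.integral_mono_on zero_le_one (ii 0 1) (by simp) (fun x _ => auxH_le_one x)
    simpa using this
  have hz : (0:ℝ) ∉ Set.uIcc 1 N := by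
    rw [Set.uIcc_of_le hN]
    intro h
    linarith [h.1]
  have iinv : IntervalIntegrable (fun s : ℝ => Real.sqrt Real.pi / 2 * s⁻¹) volume 1 N :=
    (intervalIntegrable_inv_iff.2 (Or.inr hz)).const_mul _
  have iz : IntervalIntegrable (fun s : ℝ => s ^ (-2 : ℤ)) volume 1 N :=
    intervalIntegral.intervalIntegrable_zpow (Or.inr hz)
  have i1 : ∫ s in (1:ℝ)..N, Real.sqrt Real.pi / 2 * s⁻¹ = Real.sqrt Real.pi / 2 * Real.log N := by
    rw [intervalIntegral.integral_const_mul, integral_inv hz, div_one]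
  have i2 : ∫ s in (1:ℝ)..N, s ^ (-2 : ℤ) ≤ 1 := by
    rw [integral_zpow (Or.inr ⟨by norm_num, hz⟩)]
    have : 0 ≤ N⁻¹ := by positivity
    norm_num
    linarith
  have b1 : ∫ s in (1:ℝ)..N, auxH s ≤ ∫ s in (1:ℝ)..N, Real.sqrt Real.pi / 2 * s⁻¹ :=
    intervalIntegral.integral_mono_on hN (ii 1 N) iinv
      (fun x hx => auxH_upper x (by linarith [hx.1]))
  have b2 : ∫ s in (1:ℝ)..N, (Real.sqrt Real.pi / 2 * s⁻¹ - s ^ (-2 : ℤ)) ≤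
      ∫ s in (1:ℝ)..N, auxH s :=
    intervalIntegral.integral_mono_on hN (iinv.sub iz) (ii 1 N)
      (fun x hx => auxH_lower x hx.1)
  rw [intervalIntegral.integral_sub iinv iz] at b2
  rw [abs_le]
  constructor <;> linarith

lemma aux_eq (n : ℕ) : Real.sqrt n *
    ∫ a in (0:ℝ)..1, ∫ b in (0:ℝ)..1, Real.exp (-(n : ℝ) * a ^ 2 * b ^ 2)
    = ∫ s in (0:ℝ)..(Real.sqrt n), auxH s := by
  have h := intervalIntegral.mul_integral_comp_mul_left (a := 0) (b := 1) (f := auxH) (c := Real.sqrt n)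
  rw [mul_zero, mul_one] at h
  rw [← h]
  unfold auxH
  have e : ∀ a b : ℝ, -(n : ℝ) * a ^ 2 * b ^ 2 = -1 * (Real.sqrt n * a * b) ^ 2 := by
    intro a b
    rw [mul_pow, mul_pow, Real.sq_sqrt (Nat.cast_nonneg n)]
    ring
  simp only [e]

/-- `lim_{n→∞} (√n / log n) ∫_{[0,1]²} exp(-n a² b²) da db = √π / 4`:
the singular integral with monomial phase `a²b²` (multi-index `(k₁,k₂) = (1,1)`, trivial
prior) is asymptotically `(√π/4) n^{-1/2} log n`. -/
theorem stmt_16 :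
    Tendsto (fun n : ℕ =>
        Real.sqrt n / Real.log n
          * ∫ a in (0:ℝ)..1, ∫ b in (0:ℝ)..1, Real.exp (-(n : ℝ) * a ^ 2 * b ^ 2))
      atTop (nhds (Real.sqrt Real.pi / 4)) := by
  have hlog : Tendsto (fun n : ℕ => (Real.log n)⁻¹) atTop (nhds 0) :=
    (Real.tendsto_log_atTop.comp tendsto_natCast_atTop_atTop).inv_tendsto_atTop
  rw [tendsto_iff_norm_sub_tendsto_zero]
  refine squeeze_zero' (Eventually.of_forall fun n => norm_nonneg _) ?_ hlog
  filter_upwards [eventually_ge_atTop 2] with n hn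
  have hn' : (2:ℝ) ≤ n := by exact_mod_cast hn
  have hl : 0 < Real.log n := Real.log_pos (by linarith)
  have hb := aux_bound (Real.sqrt n) (Real.one_le_sqrt.2 (by linarith))
  rw [← aux_eq, Real.log_sqrt (by linarith)] at hb
  generalize (∫ a in (0:ℝ)..1, ∫ b in (0:ℝ)..1, Real.exp (-(n : ℝ) * a ^ 2 * b ^ 2)) = I at hb ⊢
  have e : Real.sqrt n / Real.log n * I - Real.sqrt Real.pi / 4 =
      (Real.sqrt n * I - Real.sqrt Real.pi / 2 * (Real.log n / 2)) * (Real.log n)⁻¹ := by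
    field_simp
    ring
  rw [e, norm_mul, Real.norm_eq_abs, Real.norm_eq_abs, abs_of_pos (inv_pos.2 hl)]
  exact mul_le_of_le_one_left (inv_pos.2 hl).le hb
end
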